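/- arXiv:1710.06131 — 2 statements merged into one kernel-verified Lean document; each statement's English description precedes it below -/
import Mathlib

section
/- Let q be a power of the prime p with gcd(p, n) = 1, let ζ ∈ F_q with ζ^n = 1, and set m(x) = (x^n − 1)/(x − ζ) ∈ F_q[x]. If α ∈ F_{q^n} is m-free, then α is either 0-normal (normal) or 1-normal over F_q. -/
open Polynomial

noncomputable section

/-- For `f = Σ aᵢ xⁱ ∈ F_q[x]` and `α` in an extension, `f ∘ α = Σ aᵢ α^(qⁱ)`. -/
def frobComp {F K : Type*} [Field F] [Field K] [Algebra F K] (q : ℕ) (f : F[X]) (α : K) : K :=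
  ∑ i ∈ Finset.range (f.natDegree + 1), algebraMap F K (f.coeff i) * α ^ q ^ i

/-- `g` is the minimal polynomial of `α` with respect to the Frobenius `σ_q`:
monic, annihilates `α` under `∘`, and has least degree with these properties. -/
def IsFrobMinimal {F K : Type*} [Field F] [Field K] [Algebra F K] (q : ℕ) (g : F[X]) (α : K) :
    Prop :=
  g.Monic ∧ frobComp q g α = 0 ∧
    ∀ h : F[X], h.Monic → frobComp q h α = 0 → g.natDegree ≤ h.natDegree

/-- `α ∈ F_{qⁿ}` is `k`-normal over `F_q` if the `F_q`-span of `{α, α^q, …, α^(q^(n-1))}`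
has dimension `n - k`. -/
def IskNormal (q n k : ℕ) (F : Type*) {K : Type*} [Field F] [Field K] [Algebra F K] (α : K) :
    Prop :=
  Module.finrank F (Submodule.span F (Set.range fun i : Fin n => α ^ q ^ (i : ℕ))) = n - k

/-- `α` is primitive: it generates the multiplicative group of the field. -/
def IsPrimitiveElt {K : Type*} [Field K] (α : K) : Prop :=
  ∀ b : K, b ≠ 0 → ∃ m : ℕ, α ^ m = b

/-- `α` is `m`-free: `gcd(m, (xⁿ - 1)/m_{σ_q,α}) = 1`. -/
def IsPolyFree {F K : Type*} [Field F] [Field K] [Algebra F K] (q n : ℕ) (m : F[X]) (α : K) :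
    Prop :=
  ∀ g : F[X], IsFrobMinimal q g α → IsCoprime m ((X ^ n - 1) /ₘ g)

/-- `W(t)`: number of squarefree divisors of a positive integer `t`. -/
def Wint (t : ℕ) : ℕ := Set.ncard {d : ℕ | d ∣ t ∧ Squarefree d}

/-- `W(g)`: number of monic divisors of the polynomial `g`. -/
def Wpoly {F : Type*} [Field F] (g : F[X]) : ℕ := Set.ncard {h : F[X] | h.Monic ∧ h ∣ g}

/-- `Φ_q(f)`: number of units in `F_q[x]/⟨f⟩`. -/
def PhiPoly {F : Type*} [Field F] (f : F[X]) : ℕ := Nat.card (F[X] ⧸ Ideal.span {f})ˣ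


def frobL (F K : Type) [Field F] [Fintype F] [Field K] [Algebra F K] : Module.End F K :=
  (FiniteField.frobeniusAlgHom F K).toLinearMap

theorem frobL_pow (F K : Type) [Field F] [Fintype F] [Field K] [Algebra F K] (i : ℕ) (α : K) :
    (frobL F K ^ i) α = α ^ Fintype.card F ^ i := by
  induction i with
  | zero => simp
  | succ k ih =>
    rw [pow_succ', Module.End.mul_apply, ih, pow_succ, pow_mul]
    simp [frobL]

theorem frobComp_eq (F K : Type) [Field F] [Fintype F] [Field K] [Algebra F K] (f : F[X])
    (α : K) : frobComp (Fintype.card F) f α = aeval (frobL F K) f α := by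
  rw [aeval_eq_sum_range, frobComp, LinearMap.sum_apply]
  refine Finset.sum_congr rfl fun i _ => ?_
  rw [LinearMap.smul_apply, frobL_pow, Algebra.smul_def]

theorem min_le (F K : Type) [Field F] [Fintype F] [Field K] [Algebra F K] (g : F[X])
    (α : K) (hg : IsFrobMinimal (Fintype.card F) g α) (f : F[X]) (hf : f ≠ 0)
    (h0 : aeval (frobL F K) f α = 0) : g.natDegree ≤ f.natDegree := by
  have h := hg.2.2 (f * C f.leadingCoeff⁻¹) (monic_mul_leadingCoeff_inv hf) (by
    rw [frobComp_eq, mul_comm, map_mul, Module.End.mul_apply, h0, map_zero])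
  rwa [natDegree_mul_leadingCoeff_inv _ hf] at h

/-- If `gcd(p, n) = 1`, `ζⁿ = 1` in `F_q`, `m = (xⁿ - 1)/(x - ζ)` and `α ∈ F_{qⁿ}` is `m`-free,
then `α` is `0`-normal or `1`-normal over `F_q`. -/
theorem stmt_4 (p e q n : ℕ) (hp : p.Prime) (he : 0 < e) (hq : q = p ^ e)
    (hn : 0 < n) (hpn : ¬ p ∣ n)
    (F K : Type) [Field F] [Fintype F] [Field K] [Fintype K] [Algebra F K]
    (hcF : Fintype.card F = q) (hrK : Module.finrank F K = n)
    (ζ : F) (hζ : ζ ^ n = 1) (α : K)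
    (hfree : IsPolyFree q n ((X ^ n - 1 : F[X]) /ₘ (X - C ζ)) α) :
    IskNormal q n 0 F α ∨ IskNormal q n 1 F α := by
  subst hcF
  have hXm : (X ^ n - 1 : F[X]).Monic := by
    simpa using monic_X_pow_sub_C (1 : F) hn.ne'
  have hXd : (X ^ n - 1 : F[X]).natDegree = n := by
    simpa using natDegree_X_pow_sub_C (n := n) (r := (1 : F))
  have hcK : Fintype.card K = Fintype.card F ^ n := by
    rw [← hrK]; exact Module.card_eq_pow_finrank
  have hX0 : aeval (frobL F K) (X ^ n - 1 : F[X]) α = 0 := by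
    simp [frobL_pow, ← hcK, FiniteField.pow_card]
  obtain ⟨g, hg⟩ : ∃ g : F[X], IsFrobMinimal (Fintype.card F) g α := by
    let S : Set F[X] := {f | f.Monic ∧ frobComp (Fintype.card F) f α = 0}
    have hS : S.Nonempty := ⟨X ^ n - 1, hXm, by rw [frobComp_eq, hX0]⟩
    obtain ⟨g, hgS, hmin⟩ := exists_minimalFor_of_wellFoundedLT (· ∈ S) natDegree hS
    refine ⟨g, hgS.1, hgS.2, fun h h1 h2 => ?_⟩
    rcases le_total g.natDegree h.natDegree with h3 | h3
    · exact h3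
    · exact hmin (show h ∈ S from ⟨h1, h2⟩) h3
  have hga : aeval (frobL F K) g α = 0 := by rw [← frobComp_eq]; exact hg.2.1
  have hdiv : (X ^ n - 1) %ₘ g = 0 := by
    by_contra hr
    have hmod := modByMonic_add_div (X ^ n - 1 : F[X]) g
    have hr0 : aeval (frobL F K) ((X ^ n - 1) %ₘ g) α = 0 := by
      have h2 := hX0
      rw [← hmod, mul_comm, map_add, map_mul, LinearMap.add_apply, Module.End.mul_apply, hga,
        map_zero, add_zero] at h2
      exact h2
    have h1 := min_le F K g α hg _ hr hr0
    have h2 := natDegree_lt_natDegree hr (degree_modByMonic_lt (X ^ n - 1 : F[X]) hg.1)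
    omega
  have hgh : g * ((X ^ n - 1) /ₘ g) = X ^ n - 1 := by
    have := modByMonic_add_div (X ^ n - 1 : F[X]) g
    rwa [hdiv, zero_add] at this
  have hm : (X - C ζ) * ((X ^ n - 1) /ₘ (X - C ζ)) = X ^ n - 1 := by
    rw [mul_divByMonic_eq_iff_isRoot]
    simp [hζ]
  have hcop := hfree g hg
  have hhd : (X ^ n - 1) /ₘ g ∣ X - C ζ := by
    refine hcop.symm.dvd_of_dvd_mul_right ?_
    rw [hm]
    exact Dvd.intro_left g hgh
  have hdeg := natDegree_le_of_dvd hhd (X_sub_C_ne_zero ζ)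
  rw [natDegree_X_sub_C, natDegree_divByMonic _ hg.1, hXd] at hdeg
  have hgn : g.natDegree ≤ n := by
    have := min_le F K g α hg _ hXm.ne_zero hX0
    rwa [hXd] at this
  have hli : LinearIndependent F (fun i : Fin g.natDegree => (frobL F K ^ (i : ℕ)) α) := by
    rw [Fintype.linearIndependent_iff]
    intro c hc
    by_contra hne
    push Not at hne
    obtain ⟨j, hj⟩ := hne
    let f : F[X] := ∑ i : Fin g.natDegree, C (c i) * X ^ (i : ℕ)
    have hfj : f.coeff j = c j := by
      simp only [f, finset_sum_coeff, coeff_C_mul_X_pow]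
      rw [Finset.sum_eq_single j]
      · simp
      · intro b _ hb
        rw [if_neg]
        exact fun h => hb (Fin.ext h.symm)
      · simp
    have hf0 : f ≠ 0 := fun h => hj (by rw [← hfj, h, coeff_zero])
    have hfa : aeval (frobL F K) f α = 0 := by
      rw [← hc]
      simp [f, LinearMap.sum_apply, Algebra.algebraMap_eq_smul_one]
    have h1 := min_le F K g α hg f hf0 hfa
    have h2 : f.degree < g.natDegree := degree_sum_fin_lt c
    rw [← natDegree_lt_iff_degree_lt hf0] at h2
    omega
  have hle : g.natDegree ≤ Module.finrank F (Submodule.span F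
      (Set.range fun i : Fin n => α ^ Fintype.card F ^ (i : ℕ))) := by
    have h1 := finrank_span_eq_card hli
    rw [Fintype.card_fin] at h1
    rw [← h1]
    apply Submodule.finrank_mono
    apply Submodule.span_mono
    rintro _ ⟨i, rfl⟩
    exact ⟨⟨i, by omega⟩, by simp [frobL_pow]⟩
  have hub := Submodule.finrank_le (Submodule.span F
      (Set.range fun i : Fin n => α ^ Fintype.card F ^ (i : ℕ)))
  rw [hrK] at hub
  unfold IskNormal
  omega

end
end

section
/- Let q be a power of a prime p, let m be a proper divisor of n with m = 1 or m a power of p, and let f ∈ F_q[x] be a monic divisor of x^n − 1 not divisible by x − 1. Fix β ∈ F_{q^m} and let N be the number of elements w ∈ F_{q^n} that are primitive, f-free over F_q, and satisfy Tr_{q^n/q^m}(w) = β. Then N / (θ(q^n − 1) · Θ(f)) > q^{n−m} − q^{n/2} · W(q^n − 1) · W(f). -/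
open Polynomial

noncomputable section

/-- `g` is a combination of additive characters with absolute coefficient sum at most `r`. -/
def ChRep {A : Type} [AddCommGroup A] (g : A → ℂ) (r : ℝ) : Prop :=
  ∃ (ι : Type) (_ : Fintype ι) (χ : ι → AddChar A ℂ) (c : ι → ℂ),
    (∀ x, g x = ∑ i, c i * χ i x) ∧ ∑ i, ‖c i‖ ≤ r

lemma ChRep.one {A : Type} [AddCommGroup A] : ChRep (A := A) 1 1 :=
  ⟨Unit, inferInstance, fun _ => 1, fun _ => 1, by simp, by simp⟩

lemma ChRep.mul {A : Type} [AddCommGroup A] {g h : A → ℂ} {r s : ℝ}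
    (hg : ChRep g r) (hh : ChRep h s) : ChRep (g * h) (r * s) := by
  obtain ⟨ι, _, χ, c, h1, h2⟩ := hg
  obtain ⟨κ, _, ψ, d, h3, h4⟩ := hh
  refine ⟨ι × κ, inferInstance, fun x => χ x.1 * ψ x.2, fun x => c x.1 * d x.2, ?_, ?_⟩
  · intro x
    rw [Pi.mul_apply, h1, h3, Finset.sum_mul_sum, Fintype.sum_prod_type]
    refine Finset.sum_congr rfl fun i _ => Finset.sum_congr rfl fun j _ => ?_
    rw [AddChar.mul_apply]; ring
  · simp only [norm_mul]
    rw [Fintype.sum_prod_type]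
    dsimp only
    rw [← Finset.sum_mul_sum]
    gcongr
    exact (Finset.sum_nonneg fun i _ => norm_nonneg _).trans h2

lemma ChRep.prod {A J : Type} [AddCommGroup A] (s : Finset J) (g : J → A → ℂ) (r : J → ℝ)
    (hg : ∀ i ∈ s, ChRep (g i) (r i)) :
    ChRep (∏ i ∈ s, g i) (∏ i ∈ s, r i) := by
  classical
  induction s using Finset.induction_on with
  | empty => simpa using ChRep.one
  | insert a s ha ih =>
    rw [Finset.prod_insert ha, Finset.prod_insert ha]
    refine ChRep.mul (hg a (by simp)) ?_
    exact ih (fun i hi => hg i (by simp [hi]))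

lemma ChRep.norm_le {A : Type} [AddCommGroup A] [Finite A] {g : A → ℂ} {r : ℝ} (hg : ChRep g r) (x : A) :
    ‖g x‖ ≤ r := by
  obtain ⟨ι, _, χ, c, h1, h2⟩ := hg
  rw [h1]
  refine (norm_sum_le _ _).trans (le_trans ?_ h2)
  refine Finset.sum_le_sum fun i _ => ?_
  rw [norm_mul, AddChar.norm_apply, mul_one]

open Classical in
lemma ChRep.fiber {A Q : Type} [AddCommGroup A] [AddCommGroup Q] [Finite Q] (π : A →+ Q) (b : Q) :
    ChRep (fun x => if π x = b then 1 else 0) 1 := by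
  have := Fintype.ofFinite Q
  have hQ : (Fintype.card Q : ℂ) ≠ 0 := by simp
  refine ⟨AddChar Q ℂ, inferInstance, fun ψ => ψ.compAddMonoidHom π,
    fun ψ => (Fintype.card Q : ℂ)⁻¹ * ψ (-b), ?_, ?_⟩
  · intro x
    have := AddChar.sum_apply_eq_ite (π x - b)
    simp only [sub_eq_zero] at this
    have h2 : ∑ ψ : AddChar Q ℂ, (Fintype.card Q : ℂ)⁻¹ * ψ (-b) * (ψ.compAddMonoidHom π) x
      = (Fintype.card Q : ℂ)⁻¹ * ∑ ψ : AddChar Q ℂ, ψ (π x - b) := by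
      rw [Finset.mul_sum]
      refine Finset.sum_congr rfl fun ψ _ => ?_
      rw [AddChar.compAddMonoidHom_apply, sub_eq_add_neg, AddChar.map_add_eq_mul]; ring
    rw [h2, this]
    split_ifs <;> simp [*]
  · simp only [norm_mul, AddChar.norm_apply, mul_one]
    simp [AddChar.card_eq]

open Classical in
lemma ChRep.compl {A : Type} [AddCommGroup A] [Finite A] (H : AddSubgroup A) :
    ChRep (fun x => if x ∈ H then 0 else 1) (2 * (1 - 1 / (H.index : ℝ))) := by
  have := Fintype.ofFinite (A ⧸ H)
  set Q := A ⧸ H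
  have hQ : (Fintype.card Q : ℂ) ≠ 0 := by simp
  have hidx : H.index = Fintype.card Q := by
    rw [AddSubgroup.index, Nat.card_eq_fintype_card]
  let π : A →+ Q := QuotientAddGroup.mk' H
  refine ⟨AddChar Q ℂ, inferInstance, fun ψ => ψ.compAddMonoidHom π,
    fun ψ => (if ψ = 0 then 1 else 0) - (Fintype.card Q : ℂ)⁻¹, ?_, ?_⟩
  · intro x
    have := AddChar.sum_apply_eq_ite (π x)
    have h0 : π x = 0 ↔ x ∈ H := QuotientAddGroup.eq_zero_iff x
    simp only [sub_mul, Finset.sum_sub_distrib, ← Finset.mul_sum, AddChar.compAddMonoidHom_apply,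
      this, h0, ite_mul, one_mul, zero_mul]
    simp
    split_ifs <;> simp
  · rw [hidx]
    have h1 : (1 : ℝ) ≤ Fintype.card Q := by exact_mod_cast Fintype.card_pos
    have h2 : ∀ ψ : AddChar Q ℂ, ‖(if ψ = 0 then (1 : ℂ) else 0) - (Fintype.card Q : ℂ)⁻¹‖
      = (if ψ = 0 then (1 - 2 * (Fintype.card Q : ℝ)⁻¹) else 0) + (Fintype.card Q : ℝ)⁻¹ := by
      intro ψ
      split_ifs
      · have : (1 : ℂ) - (Fintype.card Q : ℂ)⁻¹ = ((1 - (Fintype.card Q : ℝ)⁻¹ : ℝ) : ℂ) := by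
          push_cast; rfl
        rw [this, Complex.norm_real, Real.norm_of_nonneg]
        · ring
        · have := inv_le_one_of_one_le₀ h1; linarith
      · simp
    simp only [h2, Finset.sum_add_distrib]
    simp [AddChar.card_eq]
    ring_nf; rfl

/-- inclusion-exclusion -/
lemma incl_excl {A J : Type} [Fintype A] (I : Finset J) (H : J → A → Prop)
    [∀ i x, Decidable (H i x)] (B : A → ℝ) (C : ℝ) (c : J → ℝ)
    (h : ∀ S ⊆ I, ∑ x, B x * ∏ i ∈ S, (if H i x then 1 else 0) = C * ∏ i ∈ S, c i) :
    ∑ x, B x * ∏ i ∈ I, (if H i x then 0 else 1) = C * ∏ i ∈ I, (1 - c i) := by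
  classical
  have e1 : ∀ u : J → ℝ, ∏ i ∈ I, (1 - u i) = ∑ S ∈ I.powerset, (-1) ^ S.card * ∏ i ∈ S, u i := by
    intro u
    simp_rw [sub_eq_add_neg]
    rw [Finset.prod_one_add]
    refine Finset.sum_congr rfl fun S _ => ?_
    rw [Finset.prod_neg]
  have e2 : ∀ x, ∏ i ∈ I, (if H i x then (0:ℝ) else 1) = ∏ i ∈ I, (1 - (if H i x then 1 else 0)) := by
    intro x
    refine Finset.prod_congr rfl fun i _ => ?_
    split_ifs <;> simp
  simp_rw [e2, e1, Finset.mul_sum]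
  rw [Finset.sum_comm]
  refine Finset.sum_congr rfl fun S hS => ?_
  have := h S (Finset.mem_powerset.1 hS)
  rw [mul_left_comm, ← this, Finset.mul_sum]
  refine Finset.sum_congr rfl fun x _ => by ring

lemma gauss_bound {K : Type} [Field K] [Fintype K] [DecidableEq K] (χ : AddChar (Additive Kˣ) ℂ) (hχ : χ ≠ 1)
    (ψ : AddChar K ℂ) :
    ‖∑ u : Kˣ, χ (Additive.ofMul u) * ψ (u : K)‖ ≤ Real.sqrt (Fintype.card K) := by
  let χ' : MulChar K ℂ := MulChar.ofUnitHom
    (MonoidHom.toHomUnits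
      { toFun := fun u : Kˣ => χ (Additive.ofMul u)
        map_one' := by simp
        map_mul' := by intro a b; simp [AddChar.map_add_eq_mul] })
  have happ : ∀ u : Kˣ, χ' (u : K) = χ (Additive.ofMul u) := by
    intro u
    simp [χ']
  have hχ' : χ' ≠ 1 := by
    intro h
    apply hχ
    ext u
    have := happ (Additive.toMul u)
    rw [h, MulChar.one_apply_coe] at this
    simpa using this.symm
  have hsum : ∑ u : Kˣ, χ (Additive.ofMul u) * ψ (u : K) = gaussSum χ' ψ := by
    rw [gaussSum]
    have h0 : ∑ x : K, χ' x * ψ x = ∑ x ∈ Finset.univ.filter (fun x : K => x ≠ 0), χ' x * ψ x := by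
      symm
      apply Finset.sum_filter_of_ne
      intro x _ hx h0
      apply hx
      rw [h0, MulChar.map_zero, zero_mul]
    rw [h0]
    refine Finset.sum_bij (fun u _ => (u : K)) (by simp) ?_ ?_ ?_
    · intro a _ b _ h; exact Units.ext h
    · intro b hb
      exact ⟨Units.mk0 b (by simpa using hb), by simp, by simp⟩
    · intro u _
      rw [happ]
  rw [hsum]
  by_cases hψ : ψ = 1
  · rw [hψ, gaussSum_one_right hχ']; simp
  · have h1 := gaussSum_mul_gaussSum_eq_card hχ' (AddChar.IsPrimitive.of_ne_one hψ)
    rw [← star_gaussSum_eq] at h1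
    have h2 : ‖gaussSum χ' ψ‖ * ‖gaussSum χ' ψ‖ = Fintype.card K := by
      have := congrArg norm h1
      rw [norm_mul, norm_star] at this
      simpa using this
    apply Real.le_sqrt_of_sq_le
    rw [sq, h2]

lemma main_estimate {K : Type} [Field K] [Fintype K] [DecidableEq K] (M : Additive Kˣ → ℂ) (A : K → ℂ)
    (r s θ : ℝ) (hθ : 0 ≤ θ) (hM : ChRep M s) (hA : ChRep A r)
    (hmean : ∑ u : Kˣ, M (Additive.ofMul u) = θ * (Fintype.card Kˣ)) :
    ‖∑ u : Kˣ, M (Additive.ofMul u) * A u - θ * ∑ u : Kˣ, A u‖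
      ≤ (s - θ) * r * Real.sqrt (Fintype.card K) := by
  classical
  obtain ⟨ι, _, χ, c, h1, h2⟩ := hM
  obtain ⟨κ, _, ψ, d, h3, h4⟩ := hA
  have hcard : (Fintype.card Kˣ : ℂ) ≠ 0 := by simp
  have hcc : Fintype.card (Additive Kˣ) = Fintype.card Kˣ := Fintype.card_congr Additive.toMul
  have htriv : ∑ i with χ i = 1, c i = θ := by
    have e : ∑ u : Kˣ, M (Additive.ofMul u) = (∑ i with χ i = 1, c i) * (Fintype.card Kˣ) := by
      simp_rw [h1]
      rw [Finset.sum_comm, Finset.sum_filter, Finset.sum_mul]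
      refine Finset.sum_congr rfl fun i _ => ?_
      rw [← Finset.mul_sum, show ∑ u : Kˣ, χ i (Additive.ofMul u) = ∑ u : Additive Kˣ, χ i u from
        Fintype.sum_equiv Additive.ofMul _ _ fun _ => rfl, AddChar.sum_eq_ite]
      simp only [← AddChar.one_eq_zero]
      split_ifs <;> simp [hcc]
    rw [e] at hmean
    exact mul_right_cancel₀ hcard hmean
  have hnon : ∑ i with χ i ≠ 1, ‖c i‖ ≤ s - θ := by
    have := Finset.sum_filter_add_sum_filter_not Finset.univ (fun i => χ i = 1) (fun i => ‖c i‖)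
    have h5 : θ ≤ ∑ i with χ i = 1, ‖c i‖ := by
      calc θ = ‖∑ i with χ i = 1, c i‖ := by
            rw [htriv, Complex.norm_real, Real.norm_of_nonneg hθ]
        _ ≤ _ := norm_sum_le _ _
    have h6 : ∑ i with χ i ≠ 1, ‖c i‖ = ∑ i with ¬ χ i = 1, ‖c i‖ := rfl
    linarith
  have hsplit : ∑ u : Kˣ, M (Additive.ofMul u) * A u - θ * ∑ u : Kˣ, A u
      = ∑ i with χ i ≠ 1, ∑ j, c i * d j * ∑ u : Kˣ, χ i (Additive.ofMul u) * ψ j (u : K) := by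
    have e1 : ∀ u : Kˣ, M (Additive.ofMul u) * A u - θ * A u
        = ∑ i with χ i ≠ 1, c i * χ i (Additive.ofMul u) * A u := by
      intro u
      rw [h1, ← Finset.sum_filter_add_sum_filter_not Finset.univ (fun i => χ i = 1), add_mul,
        Finset.sum_mul, Finset.sum_mul, ← htriv, Finset.sum_mul]
      rw [Finset.sum_congr (g := fun i => c i * A u) rfl]
      · ring
      · intro i hi
        rw [(Finset.mem_filter.1 hi).2]; simp
    rw [Finset.mul_sum, ← Finset.sum_sub_distrib]
    simp_rw [e1]
    rw [Finset.sum_comm]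
    refine Finset.sum_congr rfl fun i _ => ?_
    simp_rw [h3, Finset.mul_sum]
    rw [Finset.sum_comm]
    refine Finset.sum_congr rfl fun j _ => Finset.sum_congr rfl fun u _ => by ring
  rw [hsplit]
  calc _ ≤ ∑ i with χ i ≠ 1, ∑ j, ‖c i‖ * ‖d j‖ * Real.sqrt (Fintype.card K) := by
        refine (norm_sum_le _ _).trans (Finset.sum_le_sum fun i hi => ?_)
        refine (norm_sum_le _ _).trans (Finset.sum_le_sum fun j _ => ?_)
        rw [norm_mul, norm_mul]
        gcongr
        exact gauss_bound _ (Finset.mem_filter.1 hi).2 _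
    _ = (∑ i with χ i ≠ 1, ‖c i‖) * (∑ j, ‖d j‖) * Real.sqrt (Fintype.card K) := by
        rw [Finset.sum_mul_sum, Finset.sum_mul]
        simp_rw [Finset.sum_mul]
    _ ≤ _ := by
        gcongr
        exact (Finset.sum_nonneg fun i _ => norm_nonneg _).trans hnon

/-- the monic irreducible factors -/
def PF {F : Type} [Field F] (f : F[X]) : Finset F[X] := by
  classical exact (UniqueFactorizationMonoid.normalizedFactors f).toFinset

lemma mem_PF {F : Type} [Field F] {f P : F[X]} (hf : f ≠ 0) : P ∈ PF f ↔ Irreducible P ∧ P.Monic ∧ P ∣ f := by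
  classical
  rw [PF, Multiset.mem_toFinset]
  exact Polynomial.mem_normalizedFactors_iff hf

/-- Frobenius as a linear map -/
def sig (F K : Type) [Field F] [Fintype F] [Field K] [Algebra F K] : Module.End F K :=
  (FiniteField.frobeniusAlgHom F K).toLinearMap

section frob
variable {F K : Type} [Field F] [Fintype F] [Field K] [Algebra F K]

lemma sig_pow (i : ℕ) (w : K) : (sig F K ^ i) w = w ^ (Fintype.card F) ^ i := by
  induction i with
  | zero => simp
  | succ i ih =>
    rw [pow_succ', Module.End.mul_apply, ih]
    change (FiniteField.frobeniusAlgHom F K) _ = _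
    rw [FiniteField.coe_frobeniusAlgHom]
    simp only [← pow_mul, pow_succ]

lemma frobComp_eq_s5 (g : F[X]) (w : K) : frobComp (Fintype.card F) g w = aeval (sig F K) g w := by
  rw [frobComp, aeval_eq_sum_range, LinearMap.sum_apply]
  refine Finset.sum_congr rfl fun i _ => ?_
  rw [LinearMap.smul_apply, sig_pow, Algebra.smul_def]

lemma aeval_mul_apply (g h : F[X]) (w : K) :
    aeval (sig F K) (g * h) w = aeval (sig F K) g (aeval (sig F K) h w) := by
  rw [map_mul, Module.End.mul_apply]

variable [Fintype K]

lemma aeval_xn (w : K) : aeval (sig F K) (X ^ (Module.finrank F K) - 1 : F[X]) w = 0 := by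
  rw [map_sub, map_pow, aeval_X, map_one, LinearMap.sub_apply, sig_pow, ← Module.card_eq_pow_finrank,
    FiniteField.pow_card, Module.End.one_apply, sub_self]

lemma card_ker_le (g : F[X]) (hg : g ≠ 0) :
    Nat.card (LinearMap.ker (aeval (sig F K) g)) ≤ Fintype.card F ^ g.natDegree := by
  classical
  have hq : 1 < Fintype.card F := Fintype.one_lt_card
  set q := Fintype.card F
  let P : K[X] := ∑ i ∈ Finset.range (g.natDegree + 1), C (algebraMap F K (g.coeff i)) * X ^ q ^ i
  have hdeg : P.natDegree ≤ q ^ g.natDegree := by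
    refine natDegree_sum_le_of_forall_le _ _ fun i hi => ?_
    refine (natDegree_C_mul_X_pow_le _ _).trans ?_
    exact Nat.pow_le_pow_right hq.le (by simpa [Nat.lt_succ_iff] using hi)
  have hne : P ≠ 0 := by
    intro h
    have : P.coeff (q ^ g.natDegree) = algebraMap F K g.leadingCoeff := by
      simp only [P, finsetSum_coeff, coeff_C_mul, coeff_X_pow]
      rw [Finset.sum_eq_single g.natDegree]
      · simp
      · intro i _ hi
        rw [if_neg, mul_zero]
        intro h'
        exact hi (Nat.pow_right_injective hq h').symm
      · simp
    rw [h, coeff_zero] at this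
    exact leadingCoeff_ne_zero.2 hg ((map_eq_zero _).1 this.symm)
  have hev : ∀ w, P.eval w = aeval (sig F K) g w := by
    intro w
    rw [← frobComp_eq_s5]
    simp [P, frobComp, eval_finsetSum, q]
  calc Nat.card (LinearMap.ker (aeval (sig F K) g)) ≤ Nat.card P.roots.toFinset := by
        refine Nat.card_le_card_of_injective
          (fun w => ⟨w.1, by simp [hne, hev, LinearMap.mem_ker.1 w.2]⟩) ?_
        intro a b h
        exact Subtype.ext (by simpa using h)
    _ = P.roots.toFinset.card := Nat.card_eq_card_toFinset _ |>.trans (by simp)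
    _ ≤ P.roots.card := Multiset.toFinset_card_le _
    _ ≤ P.natDegree := card_roots' _
    _ ≤ _ := hdeg

lemma card_ker (g : F[X]) (hg : g ∣ X ^ (Module.finrank F K) - 1) :
    Nat.card (LinearMap.ker (aeval (sig F K) g)) = Fintype.card F ^ g.natDegree := by
  have hn : 0 < Module.finrank F K := Module.finrank_pos
  have hne : (X ^ (Module.finrank F K) - 1 : F[X]) ≠ 0 := X_pow_sub_C_ne_zero hn 1
  obtain ⟨h, hh⟩ := hg
  have hg0 : g ≠ 0 := by rintro rfl; simp at hh; exact hne hh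
  have hh0 : h ≠ 0 := by rintro rfl; simp at hh; exact hne hh
  have hd : g.natDegree + h.natDegree = Module.finrank F K := by
    rw [← natDegree_mul hg0 hh0, ← hh]
    exact natDegree_X_pow_sub_C (n := Module.finrank F K) (r := (1 : F))
  have h1 := card_ker_le (K := K) g hg0
  have h2 := card_ker_le (K := K) h hh0
  have h3 : Nat.card (LinearMap.range (aeval (sig F K) g)) ≤
      Nat.card (LinearMap.ker (aeval (sig F K) h)) := by
    refine Nat.card_mono (Set.toFinite _) ?_
    rintro _ ⟨w, rfl⟩
    simp only [SetLike.mem_coe, LinearMap.mem_ker]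
    rw [← aeval_mul_apply, mul_comm, ← hh, aeval_xn]
  have h4 : Nat.card (LinearMap.range (aeval (sig F K) g)) *
      Nat.card (LinearMap.ker (aeval (sig F K) g)) = Fintype.card F ^ Module.finrank F K := by
    rw [← Module.card_eq_pow_finrank, ← Nat.card_eq_fintype_card,
      Submodule.card_eq_card_quotient_mul_card (LinearMap.ker (aeval (sig F K) g)), mul_comm]
    congr 1
    exact Nat.card_congr (LinearMap.quotKerEquivRange _).symm.toEquiv
  rw [← hd, pow_add] at h4
  have hpos : 0 < Fintype.card F ^ h.natDegree := pow_pos Fintype.card_pos _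
  refine le_antisymm h1 ?_
  by_contra hlt
  push Not at hlt
  have : Nat.card (LinearMap.range (aeval (sig F K) g)) *
      Nat.card (LinearMap.ker (aeval (sig F K) g)) < Fintype.card F ^ h.natDegree * Fintype.card F ^ g.natDegree := 
    Nat.mul_lt_mul_of_le_of_lt (h3.trans h2) hlt hpos
  rw [h4, mul_comm] at this
  exact lt_irrefl _ this

lemma minimal_dvd {g h : F[X]} {w : K} (hg : IsFrobMinimal (Fintype.card F) g w)
    (hh : aeval (sig F K) h w = 0) : g ∣ h := by
  obtain ⟨hm, h0, hmin⟩ := hg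
  rw [frobComp_eq_s5] at h0
  rw [← modByMonic_eq_zero_iff_dvd hm]
  by_contra hr
  have hdiv := modByMonic_add_div h g
  have e : aeval (sig F K) (h %ₘ g) w = 0 := by
    have := congrArg (fun u => aeval (sig F K) u w) hdiv
    simp only [map_add, LinearMap.add_apply] at this
    rw [mul_comm, aeval_mul_apply, h0, hh, map_zero, add_zero] at this
    exact this
  have hl : (h %ₘ g).leadingCoeff⁻¹ ≠ 0 := inv_ne_zero (leadingCoeff_ne_zero.2 hr)
  have h1 := hmin (C (h %ₘ g).leadingCoeff⁻¹ * (h %ₘ g))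
    (by rw [mul_comm]; exact monic_mul_leadingCoeff_inv hr) (by rw [frobComp_eq_s5, aeval_mul_apply, e, map_zero])
  rw [natDegree_C_mul hl] at h1
  have h2 := natDegree_lt_natDegree hr (degree_modByMonic_lt h hm)
  omega

lemma exists_minimal (w : K) : ∃ g : F[X], IsFrobMinimal (Fintype.card F) g w := by
  classical
  have hn : 0 < Module.finrank F K := Module.finrank_pos
  have hex : ∃ d, ∃ g : F[X], g.natDegree = d ∧ g.Monic ∧ frobComp (Fintype.card F) g w = 0 :=
    ⟨_, X ^ (Module.finrank F K) - 1, rfl, monic_X_pow_sub_C 1 hn.ne', by rw [frobComp_eq_s5, aeval_xn]⟩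
  obtain ⟨g, hd, hm, h0⟩ := Nat.find_spec hex
  refine ⟨g, hm, h0, fun h hm' h0' => ?_⟩
  rw [hd]
  exact Nat.find_min' hex ⟨h, rfl, hm', h0'⟩

lemma polyFree_iff (f : F[X]) (hf : f ≠ 0) (hfd : f ∣ X ^ (Module.finrank F K) - 1) (w : K) :
    IsPolyFree (Fintype.card F) (Module.finrank F K) f w ↔
      ∀ P ∈ PF f,
        ¬ aeval (sig F K) ((X ^ (Module.finrank F K) - 1) / P) w = 0 := by
  classical
  have hn : 0 < Module.finrank F K := Module.finrank_pos
  have hne : (X ^ (Module.finrank F K) - 1 : F[X]) ≠ 0 := X_pow_sub_C_ne_zero hn 1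
  constructor
  · intro H P hP h0
    obtain ⟨hirr, -, hPf⟩ := (mem_PF hf).1 hP
    obtain ⟨g, hg⟩ := exists_minimal (F := F) w
    have hc := H g hg
    obtain ⟨k, hk⟩ := minimal_dvd hg h0
    have e : (X ^ (Module.finrank F K) - 1 : F[X]) = g * (P * k) := by
      rw [← EuclideanDomain.mul_div_cancel' hirr.ne_zero (hPf.trans hfd), hk]; ring
    rw [e, mul_divByMonic_cancel_left _ hg.1] at hc
    exact hirr.not_isUnit (hc.isUnit_of_dvd' hPf (dvd_mul_right _ _))
  · intro H g hg
    have hgd : g ∣ X ^ (Module.finrank F K) - 1 := minimal_dvd hg (aeval_xn w)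
    obtain ⟨k, hk⟩ := hgd
    rw [hk, mul_divByMonic_cancel_left _ hg.1]
    by_contra hnc
    have hk0 : k ≠ 0 := by rintro rfl; simp at hk; exact hne hk
    obtain ⟨P, hP, hPf, hPk⟩ : ∃ P, Irreducible P ∧ P ∣ f ∧ P ∣ k := by
      rw [← EuclideanDomain.gcd_isUnit_iff] at hnc
      have hg0 : EuclideanDomain.gcd f k ≠ 0 := by
        intro h; exact hf (EuclideanDomain.gcd_eq_zero_iff.1 h).1
      obtain ⟨P, hP, hd⟩ := WfDvdMonoid.exists_irreducible_factor hnc hg0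
      exact ⟨P, hP, hd.trans (EuclideanDomain.gcd_dvd_left _ _), hd.trans (EuclideanDomain.gcd_dvd_right _ _)⟩
    have hl : C P.leadingCoeff⁻¹ * P ∣ P := by
      refine ⟨C P.leadingCoeff, ?_⟩
      rw [mul_right_comm, ← C_mul, inv_mul_cancel₀ (leadingCoeff_ne_zero.2 hP.ne_zero), C_1, one_mul]
    set Q := C P.leadingCoeff⁻¹ * P with hQdef
    have hQm : Q.Monic := by rw [hQdef, mul_comm]; exact monic_mul_leadingCoeff_inv hP.ne_zero
    have hQi : Irreducible Q := by
      rw [hQdef]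
      exact (irreducible_isUnit_mul (isUnit_C.2 (IsUnit.mk0 _
        (inv_ne_zero (leadingCoeff_ne_zero.2 hP.ne_zero))))).2 hP
    have hQ0 := hQi.ne_zero
    refine H Q ((mem_PF hf).2 ⟨hQi, hQm, hl.trans hPf⟩) ?_
    obtain ⟨l, rfl⟩ := hl.trans hPk
    rw [hk, show g * (Q * l) = Q * (l * g) by ring, mul_div_cancel_left₀ _ hQ0, aeval_mul_apply,
      ← frobComp_eq_s5 g, hg.2.1, map_zero]

end frob

section quot
variable {F : Type} [Field F] [Fintype F]

lemma PF_coprime {f : F[X]} (hf : f ≠ 0) {P Q : F[X]} (hP : P ∈ PF f) (hQ : Q ∈ PF f) (h : P ≠ Q) :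
    IsCoprime P Q := by
  obtain ⟨h1, h2, -⟩ := (mem_PF hf).1 hP
  obtain ⟨h3, h4, -⟩ := (mem_PF hf).1 hQ
  refine (h1.coprime_iff_not_dvd).2 fun hd => h ?_
  exact eq_of_monic_of_associated h2 h4 (h1.associated_of_dvd h3 hd)

lemma PF_prod_dvd {f : F[X]} (hf : f ≠ 0) {S : Finset F[X]} (hS : S ⊆ PF f) {a : F[X]} :
    ∏ P ∈ S, P ∣ a ↔ ∀ P ∈ S, P ∣ a := by
  constructor
  · intro h P hP
    exact (Finset.dvd_prod_of_mem _ hP).trans h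
  · intro h
    exact Finset.prod_dvd_of_coprime (fun P hP Q hQ hne => PF_coprime hf (hS hP) (hS hQ) hne) h

lemma PF_prod_monic {f : F[X]} (hf : f ≠ 0) {S : Finset F[X]} (hS : S ⊆ PF f) :
    (∏ P ∈ S, P).Monic :=
  monic_prod_of_monic _ _ fun P hP => ((mem_PF hf).1 (hS hP)).2.1

lemma PF_natDegree {f : F[X]} (hf : f ≠ 0) {S : Finset F[X]} (hS : S ⊆ PF f) :
    (∏ P ∈ S, P).natDegree = ∑ P ∈ S, P.natDegree :=
  natDegree_prod_of_monic _ _ fun P hP => ((mem_PF hf).1 (hS hP)).2.1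

lemma PF_card_le (f : F[X]) (hf : f ≠ 0) : 2 ^ (PF f).card ≤ Wpoly f := by
  classical
  have hfin : {h : F[X] | h.Monic ∧ h ∣ f}.Finite := by
    have : Finite (degreeLT F (f.natDegree + 1)) :=
      Finite.of_equiv _ (degreeLTEquiv F (f.natDegree + 1)).symm.toEquiv
    refine Set.Finite.subset (s := (degreeLT F (f.natDegree + 1) : Set F[X])) (Set.toFinite _) ?_
    rintro h ⟨-, hd⟩
    rw [SetLike.mem_coe, mem_degreeLT]
    exact lt_of_le_of_lt degree_le_natDegree (by exact_mod_cast Nat.lt_succ_of_le (natDegree_le_of_dvd hd hf))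
  rw [Wpoly, ← Finset.card_powerset, ← Set.ncard_coe_finset]
  refine Set.ncard_le_ncard_of_injOn (fun S => ∏ P ∈ S, P) ?_ ?_ hfin
  · intro S hS
    have hS := Finset.mem_powerset.1 hS
    exact ⟨PF_prod_monic hf hS, (PF_prod_dvd hf hS).2 fun P hP => ((mem_PF hf).1 (hS hP)).2.2⟩
  · have key : ∀ S ⊆ PF f, ∀ T ⊆ PF f, ∏ P ∈ S, P ∣ ∏ P ∈ T, P → S ⊆ T := by
      intro S hS T hT h P hP
      by_contra hn
      have h1 := (mem_PF hf).1 (hS hP)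
      have h2 : IsCoprime P (∏ P ∈ T, P) := IsCoprime.prod_right fun Q hQ =>
        PF_coprime hf (hS hP) (hT hQ) (by rintro rfl; exact hn hQ)
      exact h1.1.not_isUnit (h2.isUnit_of_dvd' dvd_rfl ((Finset.dvd_prod_of_mem _ hP).trans h))
    intro S hS T hT h
    have hS := Finset.mem_powerset.1 hS
    have hT := Finset.mem_powerset.1 hT
    exact Finset.Subset.antisymm (key S hS T hT (dvd_of_eq h)) (key T hT S hS (dvd_of_eq h.symm))

lemma card_quot (h : F[X]) (hh : h ≠ 0) :
    Nat.card (F[X] ⧸ Ideal.span {h}) = Fintype.card F ^ h.natDegree := by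
  have hfr : Module.finrank F (F[X] ⧸ Ideal.span {h}) = h.natDegree := finrank_quotient_span_eq_natDegree
  have : Module.Finite F (F[X] ⧸ Ideal.span {h}) := (AdjoinRoot.powerBasis hh).finite
  rw [Module.natCard_eq_pow_finrank (K := F), hfr, Nat.card_eq_fintype_card]

open Classical in
lemma phi_formula (f : F[X]) (hf : f ≠ 0) :
    (PhiPoly f : ℝ) = (Fintype.card F : ℝ) ^ f.natDegree *
      ∏ P ∈ PF f, (1 - 1 / (Fintype.card F : ℝ) ^ P.natDegree) := by
  have hq : 0 < Fintype.card F := Fintype.card_pos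
  have hfinh : ∀ h : F[X], h ≠ 0 → Finite (F[X] ⧸ Ideal.span {h}) := fun h hh =>
    Nat.finite_of_card_ne_zero (by rw [card_quot h hh]; positivity)
  have := hfinh f hf
  have := Fintype.ofFinite (F[X] ⧸ Ideal.span {f})
  have hrep : ∀ (h a : F[X]), h ∣ f → ((∃ b, Ideal.Quotient.mk (Ideal.span {f}) b
      = Ideal.Quotient.mk (Ideal.span {f}) a ∧ h ∣ b) ↔ h ∣ a) := by
    intro h a hd
    constructor
    · rintro ⟨b, hb, hd'⟩
      rw [Ideal.Quotient.eq, Ideal.mem_span_singleton] at hb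
      exact (dvd_sub_right hd').1 (hd.trans hb) 
    · intro h; exact ⟨a, rfl, h⟩
  have hcount : ∀ h : F[X], h ∣ f → (Nat.card {x : F[X] ⧸ Ideal.span {f} //
      ∃ b, Ideal.Quotient.mk (Ideal.span {f}) b = x ∧ h ∣ b} : ℝ)
      = (Fintype.card F : ℝ) ^ f.natDegree * (1 / (Fintype.card F : ℝ) ^ h.natDegree) := by
    intro h hd
    have hh : h ≠ 0 := by rintro rfl; exact hf (zero_dvd_iff.1 hd)
    have hle : Ideal.span {f} ≤ Ideal.span {h} := by rwa [Ideal.span_singleton_le_span_singleton]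
    let φ := Ideal.Quotient.factor hle
    have hs : Function.Surjective φ := Ideal.Quotient.factor_surjective hle
    have hk : Nat.card {x : F[X] ⧸ Ideal.span {f} //
      ∃ b, Ideal.Quotient.mk (Ideal.span {f}) b = x ∧ h ∣ b} = Nat.card φ.toAddMonoidHom.ker := by
      refine Nat.card_congr (Equiv.subtypeEquivRight fun x => ?_)
      obtain ⟨a, rfl⟩ := Ideal.Quotient.mk_surjective x
      rw [hrep h a hd]
      change _ ↔ φ (Ideal.Quotient.mk _ a) = 0
      rw [Ideal.Quotient.factor_mk, Ideal.Quotient.eq_zero_iff_mem, Ideal.mem_span_singleton]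
    have e := AddSubgroup.card_eq_card_quotient_mul_card_addSubgroup φ.toAddMonoidHom.ker
    rw [Nat.card_congr (QuotientAddGroup.quotientKerEquivOfSurjective φ.toAddMonoidHom hs).toEquiv,
      card_quot f hf, card_quot h hh] at e
    rw [hk]
    have e' : (Fintype.card F : ℝ) ^ f.natDegree = (Fintype.card F : ℝ) ^ h.natDegree * Nat.card φ.toAddMonoidHom.ker := by
      exact_mod_cast e
    rw [e']
    field_simp
  have key := incl_excl (A := F[X] ⧸ Ideal.span {f}) (PF f)
    (fun P x => ∃ b, Ideal.Quotient.mk (Ideal.span {f}) b = x ∧ P ∣ b) (fun _ => 1)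
    ((Fintype.card F : ℝ) ^ f.natDegree) (fun P => 1 / (Fintype.card F : ℝ) ^ P.natDegree) ?_
  · rw [← key, PhiPoly]
    have e1 : ∀ x : F[X] ⧸ Ideal.span {f}, (1 : ℝ) * ∏ i ∈ PF f, (if ∃ b, Ideal.Quotient.mk (Ideal.span {f}) b = x ∧ i ∣ b then (0 : ℝ) else 1)
        = if IsUnit x then 1 else 0 := by
      intro x
      obtain ⟨a, rfl⟩ := Ideal.Quotient.mk_surjective x
      have hu : IsUnit (Ideal.Quotient.mk (Ideal.span {f}) a) ↔ ∀ P ∈ PF f, ¬ P ∣ a := by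
        constructor
        · intro hu P hP hd
          obtain ⟨h1, -, h3⟩ := (mem_PF hf).1 hP
          obtain ⟨y, hy⟩ := hu.exists_right_inv
          obtain ⟨b, rfl⟩ := Ideal.Quotient.mk_surjective y
          rw [← map_mul, ← map_one (Ideal.Quotient.mk _), Ideal.Quotient.eq, Ideal.mem_span_singleton] at hy
          refine h1.not_isUnit (isUnit_of_dvd_one ?_)
          exact (dvd_sub_right (hd.mul_right b)).1 (h3.trans hy)
        · intro H
          have hc : IsCoprime a f := by
            by_contra hnc
            rw [← EuclideanDomain.gcd_isUnit_iff] at hnc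
            have hg0 : EuclideanDomain.gcd a f ≠ 0 := by
              intro h; exact hf (EuclideanDomain.gcd_eq_zero_iff.1 h).2
            obtain ⟨P, hPm, hP, hd⟩ := exists_monic_irreducible_factor _ hnc
            exact H P ((mem_PF hf).2 ⟨hP, hPm, hd.trans (EuclideanDomain.gcd_dvd_right _ _)⟩)
              (hd.trans (EuclideanDomain.gcd_dvd_left _ _))
          obtain ⟨u, v, huv⟩ := hc
          refine IsUnit.of_mul_eq_one (Ideal.Quotient.mk _ u) ?_
          rw [← map_mul, ← map_one (Ideal.Quotient.mk _), Ideal.Quotient.eq, Ideal.mem_span_singleton]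
          exact ⟨-v, by linear_combination huv⟩
      rw [one_mul]
      split_ifs with hc <;> rw [hu] at hc
      · refine Finset.prod_eq_one fun P hP => if_neg ?_
        rw [hrep P a ((mem_PF hf).1 hP).2.2]
        exact hc P hP
      · push Not at hc
        obtain ⟨P, hP, hd⟩ := hc
        refine Finset.prod_eq_zero hP (if_pos ⟨a, rfl, hd⟩)
    simp_rw [e1]
    rw [Finset.sum_boole]
    norm_cast
    rw [← Fintype.card_subtype, ← Nat.card_eq_fintype_card]
    refine Nat.card_congr ?_
    exact Equiv.ofBijective (fun u => ⟨u.1, u.isUnit⟩) ⟨fun u v h => Units.ext (by simpa using h),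
      fun ⟨x, hx⟩ => ⟨hx.unit, by simp⟩⟩
  · intro S hS
    rw [Finset.prod_div_distrib, Finset.prod_const_one, Finset.prod_pow_eq_pow_sum, ← PF_natDegree hf hS,
      ← hcount _ ((PF_prod_dvd hf hS).2 fun P hP => ((mem_PF hf).1 (hS hP)).2.2)]
    have e1 : ∀ x : F[X] ⧸ Ideal.span {f}, (1 : ℝ) * ∏ i ∈ S, (if ∃ b, Ideal.Quotient.mk (Ideal.span {f}) b = x ∧ i ∣ b then (1 : ℝ) else 0)
        = if ∃ b, Ideal.Quotient.mk (Ideal.span {f}) b = x ∧ (∏ P ∈ S, P) ∣ b then 1 else 0 := by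
      intro x
      obtain ⟨a, rfl⟩ := Ideal.Quotient.mk_surjective x
      have h1 : ∀ P ∈ S, P ∣ f := fun P hP => ((mem_PF hf).1 (hS hP)).2.2
      rw [one_mul, Finset.prod_boole, hrep _ a ((PF_prod_dvd hf hS).2 h1), PF_prod_dvd hf hS]
      congr 1
      simp only [eq_iff_iff]
      exact forall₂_congr fun P hP => hrep P a (h1 P hP)
    simp_rw [e1]
    rw [Finset.sum_boole, ← Fintype.card_subtype, Nat.card_eq_fintype_card]

end quot

section count
variable {F K : Type} [Field F] [Fintype F] [Field K] [Algebra F K] [Fintype K]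

lemma annih_iff (w : K) : ∃ k : F[X], ∀ D : F[X], D ∣ X ^ (Module.finrank F K) - 1 →
    (aeval (sig F K) ((X ^ (Module.finrank F K) - 1) / D) w = 0 ↔ D ∣ k) := by
  have hn : 0 < Module.finrank F K := Module.finrank_pos
  have hne : (X ^ (Module.finrank F K) - 1 : F[X]) ≠ 0 := X_pow_sub_C_ne_zero hn 1
  obtain ⟨g, hg⟩ := exists_minimal (F := F) w
  obtain ⟨k, hk⟩ := minimal_dvd hg (aeval_xn w)
  refine ⟨k, fun D hD => ?_⟩
  have hD0 : D ≠ 0 := by rintro rfl; exact hne (zero_dvd_iff.1 hD)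
  constructor
  · intro h
    obtain ⟨l, hl⟩ := minimal_dvd hg h
    have e : g * k = g * (D * l) := by
      rw [← hk, ← EuclideanDomain.mul_div_cancel' hD0 hD, hl]; ring
    rw [mul_left_cancel₀ hg.1.ne_zero e]
    exact dvd_mul_right _ _
  · rintro ⟨l, rfl⟩
    rw [hk, show g * (D * l) = D * (l * g) by ring, mul_div_cancel_left₀ _ hD0, aeval_mul_apply,
      ← frobComp_eq_s5 g, hg.2.1, map_zero]

lemma index_ker_div (P : F[X]) (hP : P ∣ X ^ (Module.finrank F K) - 1) :
    (LinearMap.ker (aeval (sig F K) ((X ^ (Module.finrank F K) - 1) / P))).toAddSubgroup.index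
      = Fintype.card F ^ P.natDegree := by
  have hn : 0 < Module.finrank F K := Module.finrank_pos
  have hne : (X ^ (Module.finrank F K) - 1 : F[X]) ≠ 0 := X_pow_sub_C_ne_zero hn 1
  have hP0 : P ≠ 0 := by rintro rfl; exact hne (zero_dvd_iff.1 hP)
  set D := (X ^ (Module.finrank F K) - 1) / P
  have hD : P * D = X ^ (Module.finrank F K) - 1 := EuclideanDomain.mul_div_cancel' hP0 hP
  have hD0 : D ≠ 0 := by intro h; rw [h, mul_zero] at hD; exact hne hD.symm
  have hd : P.natDegree + D.natDegree = Module.finrank F K := by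
    rw [← natDegree_mul hP0 hD0, hD]
    exact natDegree_X_pow_sub_C (n := Module.finrank F K) (r := (1 : F))
  have h1 := card_ker (K := K) D ⟨P, by rw [← hD, mul_comm]⟩
  have h2 := AddSubgroup.index_mul_card (LinearMap.ker (aeval (sig F K) D)).toAddSubgroup
  have h3 : Nat.card (LinearMap.ker (aeval (sig F K) D)).toAddSubgroup
    = Nat.card (LinearMap.ker (aeval (sig F K) D)) := rfl
  rw [h3, h1, Nat.card_eq_fintype_card, Module.card_eq_pow_finrank (K := F) (V := K), ← hd, pow_add] at h2
  exact Nat.eq_of_mul_eq_mul_right (pow_pos Fintype.card_pos _) h2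

variable {E : Type} [Field E] [Fintype E] [Algebra F E] [Algebra E K] [IsScalarTower F E K]

lemma fiber_count (β : E) (h : F[X]) (hd : h ∣ X ^ (Module.finrank F K) - 1)
    (hc : IsCoprime h (X ^ (Module.finrank F E) - 1)) :
    (Nat.card {w : K // Algebra.trace E K w = β ∧
      aeval (sig F K) ((X ^ (Module.finrank F K) - 1) / h) w = 0} : ℝ)
      = (Fintype.card F : ℝ) ^ (Module.finrank F K - Module.finrank F E)
        * (1 / (Fintype.card F : ℝ) ^ h.natDegree) := by
  have hn : 0 < Module.finrank F K := Module.finrank_pos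
  have hm : 0 < Module.finrank F E := Module.finrank_pos
  have hmk := Module.finrank_mul_finrank F E K
  have hne : (X ^ (Module.finrank F K) - 1 : F[X]) ≠ 0 := X_pow_sub_C_ne_zero hn 1
  have hnem : (X ^ (Module.finrank F E) - 1 : F[X]) ≠ 0 := X_pow_sub_C_ne_zero hm 1
  have hh0 : h ≠ 0 := by rintro rfl; exact hne (zero_dvd_iff.1 hd)
  let T : F[X] := ∑ i ∈ Finset.range (Module.finrank E K), (X ^ Module.finrank F E) ^ i
  have hT : T * (X ^ (Module.finrank F E) - 1) = X ^ (Module.finrank F K) - 1 := by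
    rw [geom_sum_mul, ← pow_mul, hmk]
  have hTr : ∀ w : K, algebraMap E K (Algebra.trace E K w) = aeval (sig F K) T w := by
    intro w
    rw [FiniteField.algebraMap_trace_eq_sum_pow]
    simp only [T, map_sum, LinearMap.sum_apply, ← pow_mul, map_pow, aeval_X, sig_pow]
    refine Finset.sum_congr rfl fun i _ => ?_
    rw [Nat.card_eq_fintype_card, Module.card_eq_pow_finrank (K := F) (V := E), ← pow_mul]
  have hinj : Function.Injective (algebraMap E K) := (algebraMap E K).injective
  obtain ⟨t, ht⟩ : h ∣ T := hc.dvd_of_dvd_mul_right (by rw [hT]; exact hd)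
  have hT0 : T ≠ 0 := by intro h0; rw [h0, zero_mul] at hT; exact hne hT.symm
  have ht0 : t ≠ 0 := by rintro rfl; rw [mul_zero] at ht; exact hT0 ht
  have hG : (X ^ (Module.finrank F K) - 1) / h = t * (X ^ (Module.finrank F E) - 1) := by
    rw [← hT, ht, mul_assoc, mul_div_cancel_left₀ _ hh0]
  have hdeg : h.natDegree + t.natDegree + Module.finrank F E = Module.finrank F K := by
    have := congrArg natDegree hT
    rw [natDegree_mul hT0 hnem, ht, natDegree_mul hh0 ht0] at this
    have e1 : (X ^ (Module.finrank F E) - 1 : F[X]).natDegree = _ := natDegree_X_pow_sub_C (n := Module.finrank F E) (r := (1 : F))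
    have e2 : (X ^ (Module.finrank F K) - 1 : F[X]).natDegree = _ := natDegree_X_pow_sub_C (n := Module.finrank F K) (r := (1 : F))
    omega
  obtain ⟨u, v, huv⟩ := hc
  obtain ⟨w0, hw0⟩ := Algebra.trace_surjective E K β
  have hfix : ∀ b : E, aeval (sig F K) (X ^ (Module.finrank F E) - 1 : F[X]) (algebraMap E K b) = 0 := by
    intro b
    rw [map_sub, map_pow, aeval_X, map_one, LinearMap.sub_apply, sig_pow, ← Module.card_eq_pow_finrank,
      ← map_pow, FiniteField.pow_card, Module.End.one_apply, sub_self]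
  set w1 := aeval (sig F K) (h * u) w0 with hw1
  have hw1T : aeval (sig F K) T w1 = algebraMap E K β := by
    rw [hw1, ← aeval_mul_apply, mul_comm, aeval_mul_apply, ← hTr, hw0,
      show h * u = 1 - v * (X ^ (Module.finrank F E) - 1) by linear_combination huv,
      map_sub, LinearMap.sub_apply, aeval_mul_apply, hfix]
    simp
  have hw1G : aeval (sig F K) (t * (X ^ (Module.finrank F E) - 1)) w1 = 0 := by
    rw [hw1, ← aeval_mul_apply, show t * (X ^ (Module.finrank F E) - 1) * (h * u)
      = u * ((h * t) * (X ^ (Module.finrank F E) - 1)) by ring, ← ht, hT, aeval_mul_apply, aeval_xn, map_zero]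
  have hcard : Nat.card {w : K // Algebra.trace E K w = β ∧
      aeval (sig F K) ((X ^ (Module.finrank F K) - 1) / h) w = 0}
      = Nat.card (LinearMap.ker (aeval (sig F K) t)) := by
    refine Nat.card_congr ((Equiv.subRight w1).subtypeEquiv fun w => ?_)
    rw [hG, Equiv.subRight_apply, LinearMap.mem_ker, ← hinj.eq_iff, hTr, ← hw1T]
    constructor
    · rintro ⟨h1, h2⟩
      rw [show t = u * T + v * (t * (X ^ (Module.finrank F E) - 1)) by
        rw [ht]; linear_combination (-t) * huv]
      rw [map_add, LinearMap.add_apply, aeval_mul_apply, aeval_mul_apply v, map_sub, map_sub (aeval (sig F K) (t * _)), h1, h2, hw1G]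
      simp
    · intro h1
      have h2 : ∀ s : F[X], aeval (sig F K) (s * t) w = aeval (sig F K) (s * t) w1 := by
        intro s
        rw [← sub_eq_zero, ← map_sub, aeval_mul_apply, h1, map_zero]
      refine ⟨by rw [ht, h2], ?_⟩
      rw [mul_comm, h2, mul_comm, hw1G]
  rw [hcard, card_ker t ⟨h * (X ^ (Module.finrank F E) - 1), by rw [← hT, ht]; ring⟩]
  rw [show Module.finrank F K - Module.finrank F E = h.natDegree + t.natDegree by omega]
  have : (Fintype.card F : ℝ) ≠ 0 := by simp
  push_cast
  rw [pow_add]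
  field_simp

open Classical in
lemma free_count (β : E) (f : F[X]) (hf : f ≠ 0) (hd : f ∣ X ^ (Module.finrank F K) - 1)
    (hc : IsCoprime f (X ^ (Module.finrank F E) - 1)) :
    ∑ w : K, (if Algebra.trace E K w = β then (1 : ℝ) else 0) *
      ∏ P ∈ PF f, (if aeval (sig F K) ((X ^ (Module.finrank F K) - 1) / P) w = 0 then 0 else 1)
      = (Fintype.card F : ℝ) ^ (Module.finrank F K - Module.finrank F E)
        * ∏ P ∈ PF f, (1 - 1 / (Fintype.card F : ℝ) ^ P.natDegree) := by
  refine incl_excl (PF f) (fun P w => aeval (sig F K) ((X ^ (Module.finrank F K) - 1) / P) w = 0) _ _ _ ?_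
  intro S hS
  have hSf : ∏ P ∈ S, P ∣ f := (PF_prod_dvd hf hS).2 fun P hP => ((mem_PF hf).1 (hS hP)).2.2
  rw [Finset.prod_div_distrib, Finset.prod_const_one, Finset.prod_pow_eq_pow_sum, ← PF_natDegree hf hS,
    ← fiber_count β (∏ P ∈ S, P) (hSf.trans hd) (hc.of_isCoprime_of_dvd_left hSf),
    Nat.card_eq_fintype_card, Fintype.card_subtype, ← Finset.sum_boole]
  refine Finset.sum_congr rfl fun w _ => ?_
  obtain ⟨k, hk⟩ := annih_iff (F := F) w
  have hiff : aeval (sig F K) ((X ^ (Module.finrank F K) - 1) / ∏ P ∈ S, P) w = 0 ↔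
      ∀ P ∈ S, aeval (sig F K) ((X ^ (Module.finrank F K) - 1) / P) w = 0 := by
    rw [hk _ (hSf.trans hd), PF_prod_dvd hf hS]
    exact forall₂_congr fun P hP => (hk P (((mem_PF hf).1 (hS hP)).2.2.trans hd)).symm
  rw [Finset.prod_boole, ite_mul, one_mul, zero_mul, ← ite_and]
  simp only [hiff]

end count

lemma Wint_ge (N : ℕ) (hN : N ≠ 0) : 2 ^ N.primeFactors.card ≤ Wint N := by
  classical
  have h1 : {d : ℕ | d ∣ N ∧ Squarefree d} = ((N.divisors.filter Squarefree : Finset ℕ) : Set ℕ) := by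
    ext d; simp [hN]
  rw [Wint, h1, Set.ncard_coe_finset, Finset.card_eq_sum_ones (N.divisors.filter Squarefree), Nat.sum_divisors_filter_squarefree hN]
  rw [← Finset.card_eq_sum_ones, Finset.card_powerset]
  rw [Nat.factors_eq]
  exact le_of_eq rfl

section mult
variable {K : Type} [Field K] [Fintype K] [DecidableEq K]

/-- kernel of the power map -/
def Hl (K : Type) [Field K] [Fintype K] [DecidableEq K] (l : ℕ) : AddSubgroup (Additive Kˣ) :=
  (nsmulAddMonoidHom (Fintype.card Kˣ / l) : Additive Kˣ →+ Additive Kˣ).ker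

lemma mem_Hl (l : ℕ) (u : Kˣ) : Additive.ofMul u ∈ Hl K l ↔ u ^ (Fintype.card Kˣ / l) = 1 := by
  rw [Hl, AddMonoidHom.mem_ker]
  exact Iff.rfl

lemma index_Hl (l : ℕ) (hl : l ∣ Fintype.card Kˣ) : (Hl K l).index = l := by
  have h0 : 0 < Fintype.card Kˣ := Fintype.card_pos
  rw [Hl, IsAddCyclic.index_nsmulAddMonoidHom_ker]
  have e : Nat.card (Additive Kˣ) = Fintype.card Kˣ := by
    rw [← Nat.card_eq_fintype_card]; exact Nat.card_congr Additive.toMul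
  rw [e, Nat.gcd_eq_right (Nat.div_dvd_of_dvd hl), Nat.div_div_self hl h0.ne']

lemma prim_iff (u : Kˣ) : IsPrimitiveElt (u : K) ↔ orderOf u = Fintype.card Kˣ := by
  constructor
  · intro h
    refine (orderOf_eq_card_of_forall_mem_zpowers (g := u) ?_).trans Nat.card_eq_fintype_card
    intro v
    obtain ⟨k, hk⟩ := h v v.ne_zero
    exact ⟨k, Units.ext (by simpa using hk)⟩
  · intro h b hb
    have h1 : Units.mk0 b hb ∈ Subgroup.zpowers u := by
      have := Subgroup.eq_top_of_card_eq (Subgroup.zpowers u)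
        (by rw [Nat.card_zpowers, h, Nat.card_eq_fintype_card])
      rw [this]; trivial
    rw [← mem_powers_iff_mem_zpowers] at h1
    obtain ⟨k, hk⟩ := h1
    exact ⟨k, by simpa using congrArg Units.val hk⟩

lemma order_iff (u : Kˣ) : orderOf u = Fintype.card Kˣ ↔
    ∀ l ∈ (Fintype.card Kˣ).primeFactors, ¬ Additive.ofMul u ∈ Hl K l := by
  have h0 : 0 < Fintype.card Kˣ := Fintype.card_pos
  constructor
  · intro h l hl hm
    rw [mem_Hl] at hm
    have hp := Nat.prime_of_mem_primeFactors hl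
    have hd := Nat.dvd_of_mem_primeFactors hl
    have h1 := orderOf_dvd_of_pow_eq_one hm
    rw [h] at h1
    have h2 := Nat.le_of_dvd (Nat.div_pos (Nat.le_of_dvd h0 hd) hp.pos) h1
    exact absurd h2 (not_le.2 (Nat.div_lt_self h0 hp.one_lt))
  · intro h
    refine orderOf_eq_of_pow_and_pow_div_prime h0 pow_card_eq_one ?_
    intro l hp hd
    have := h l (Nat.mem_primeFactors.2 ⟨hp, hd, h0.ne'⟩)
    rwa [mem_Hl] at this

open Classical in
lemma prod_Hl (u : Kˣ) : (∏ l ∈ (Fintype.card Kˣ).primeFactors,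
    fun x : Additive Kˣ => if x ∈ Hl K l then (0 : ℂ) else 1) (Additive.ofMul u)
    = if IsPrimitiveElt (u : K) then 1 else 0 := by
  rw [Finset.prod_apply]
  have : IsPrimitiveElt (u : K) ↔ ∀ l ∈ (Fintype.card Kˣ).primeFactors, ¬ Additive.ofMul u ∈ Hl K l :=
    (prim_iff u).trans (order_iff u)
  simp only [this]
  rw [← Finset.prod_boole]
  refine Finset.prod_congr rfl fun l _ => ?_
  split_ifs <;> rfl

open Classical in
lemma rep_M : ChRep (∏ l ∈ (Fintype.card Kˣ).primeFactors,
    fun x : Additive Kˣ => if x ∈ Hl K l then (0 : ℂ) else 1)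
    (2 ^ (Fintype.card Kˣ).primeFactors.card *
      ((Nat.totient (Fintype.card Kˣ) : ℝ) / (Fintype.card Kˣ))) := by
  have e : (2 ^ (Fintype.card Kˣ).primeFactors.card *
      ((Nat.totient (Fintype.card Kˣ) : ℝ) / (Fintype.card Kˣ)))
      = ∏ l ∈ (Fintype.card Kˣ).primeFactors, (2 * (1 - 1 / (l : ℝ))) := by
    rw [Finset.prod_mul_distrib, Finset.prod_const]
    congr 1
    have := Nat.totient_eq_mul_prod_factors (Fintype.card Kˣ)
    have h2 : ((Nat.totient (Fintype.card Kˣ) : ℚ) : ℝ) = _ := congrArg (fun x : ℚ => (x : ℝ)) this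
    push_cast at h2
    rw [h2]
    have : (Fintype.card Kˣ : ℝ) ≠ 0 := by simp
    field_simp
  rw [e]
  refine ChRep.prod _ _ _ fun l hl => ?_
  have := ChRep.compl (Hl K l)
  rwa [index_Hl l (Nat.dvd_of_mem_primeFactors hl)] at this

open Classical in
lemma mean_M : ∑ u : Kˣ, (∏ l ∈ (Fintype.card Kˣ).primeFactors,
    fun x : Additive Kˣ => if x ∈ Hl K l then (0 : ℂ) else 1) (Additive.ofMul u)
    = (((Nat.totient (Fintype.card Kˣ) : ℝ) / (Fintype.card Kˣ) : ℝ) : ℂ) * (Fintype.card Kˣ) := by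
  have h0 : (Fintype.card Kˣ : ℂ) ≠ 0 := by simp
  simp_rw [prod_Hl, prim_iff]
  rw [Finset.sum_boole, IsCyclic.card_orderOf_eq_totient dvd_rfl]
  push_cast
  field_simp

end mult


section core
variable {F E K : Type} [Field F] [Fintype F] [Field E] [Fintype E] [Field K] [Fintype K]
    [Algebra F E] [Algebra E K] [Algebra F K] [IsScalarTower F E K]

open Classical in
/-- the indicator of free elements with prescribed trace -/
def AA (f : F[X]) (β : E) : K → ℂ :=
  (∏ P ∈ PF f, fun w : K => if w ∈ (LinearMap.ker (aeval (sig F K)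
      ((X ^ (Module.finrank F K) - 1 : F[X]) / P))).toAddSubgroup then (0 : ℂ) else 1) *
    (fun w : K => if (Algebra.trace E K).toAddMonoidHom w = β then (1 : ℂ) else 0)

open Classical in
lemma AA_eq (f : F[X]) (β : E) (w : K) : AA f β w =
    (((if Algebra.trace E K w = β then (1:ℝ) else 0) *
      ∏ P ∈ PF f, (if aeval (sig F K) ((X ^ (Module.finrank F K) - 1 : F[X]) / P) w = 0
        then (0:ℝ) else 1) : ℝ) : ℂ) := by
  rw [AA, Pi.mul_apply, Finset.prod_apply, mul_comm]
  push_cast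
  refine congrArg₂ (· * ·) ?_ (Finset.prod_congr rfl fun P _ => ?_)
  · by_cases h : Algebra.trace E K w = β
    · have h' : (Algebra.trace E K).toAddMonoidHom w = β := h
      rw [if_pos h, if_pos h', Complex.ofReal_one]
    · have h' : ¬ (Algebra.trace E K).toAddMonoidHom w = β := h
      rw [if_neg h, if_neg h', Complex.ofReal_zero]
  · simp only [Submodule.mem_toAddSubgroup, LinearMap.mem_ker]
    split_ifs <;> simp

open Classical in
lemma AA_ind (f : F[X]) (hf : f ≠ 0) (hfd : f ∣ X ^ (Module.finrank F K) - 1) (β : E) (w : K) :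
    AA f β w = if IsPolyFree (Fintype.card F) (Module.finrank F K) f w ∧
      Algebra.trace E K w = β then 1 else 0 := by
  rw [AA_eq]
  simp only [polyFree_iff f hf hfd w]
  have : (∏ P ∈ PF f, (if aeval (sig F K) ((X ^ (Module.finrank F K) - 1 : F[X]) / P) w = 0
        then (0:ℝ) else 1)) = if (∀ P ∈ PF f, ¬ aeval (sig F K)
        ((X ^ (Module.finrank F K) - 1 : F[X]) / P) w = 0) then 1 else 0 := by
    rw [← Finset.prod_boole]
    refine Finset.prod_congr rfl fun l _ => ?_
    split_ifs <;> rfl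
  rw [this]
  split_ifs <;> simp_all

lemma AA_rep (f : F[X]) (hf : f ≠ 0) (hfd : f ∣ X ^ (Module.finrank F K) - 1) (β : E) :
    ChRep (AA (K := K) f β) (2 ^ (PF f).card *
      ∏ P ∈ PF f, (1 - 1 / (Fintype.card F : ℝ) ^ P.natDegree)) := by
  classical
  have e : (2 ^ (PF f).card * ∏ P ∈ PF f, (1 - 1 / (Fintype.card F : ℝ) ^ P.natDegree))
      = (∏ P ∈ PF f, (2 * (1 - 1 / (Fintype.card F : ℝ) ^ P.natDegree))) * 1 := by
    rw [Finset.prod_mul_distrib, Finset.prod_const, mul_one]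
  rw [e]
  refine ChRep.mul (ChRep.prod _ _ _ fun P hP => ?_) (ChRep.fiber _ _)
  have := ChRep.compl (LinearMap.ker (aeval (sig F K)
      ((X ^ (Module.finrank F K) - 1 : F[X]) / P))).toAddSubgroup
  rw [index_ker_div P (((mem_PF hf).1 hP).2.2.trans hfd)] at this
  push_cast at this
  exact this

lemma AA_sum (f : F[X]) (hf : f ≠ 0) (hfd : f ∣ X ^ (Module.finrank F K) - 1)
    (hc : IsCoprime f (X ^ (Module.finrank F E) - 1)) (β : E) :
    ∑ w : K, AA f β w = (((Fintype.card F : ℝ) ^ (Module.finrank F K - Module.finrank F E) *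
      ∏ P ∈ PF f, (1 - 1 / (Fintype.card F : ℝ) ^ P.natDegree) : ℝ) : ℂ) := by
  classical
  rw [← free_count (K := K) β f hf hfd hc, Complex.ofReal_sum]
  exact Finset.sum_congr rfl fun w _ => AA_eq f β w

lemma sum_units_eq [DecidableEq K] (A : K → ℂ) : ∑ w : K, A w = A 0 + ∑ u : Kˣ, A u := by
  rw [← Finset.add_sum_erase _ _ (Finset.mem_univ (0 : K))]
  congr 1
  symm
  refine Finset.sum_bij (fun u _ => (u : K)) ?_ ?_ ?_ ?_
  · intro u _; simp
  · intro u _ v _ h; exact Units.ext h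
  · intro b hb
    have hb0 : b ≠ 0 := (Finset.mem_erase.1 hb).1
    exact ⟨Units.mk0 b hb0, Finset.mem_univ _, rfl⟩
  · intro u _; rfl

lemma not_prim_zero (h2 : 2 < Fintype.card K) : ¬ IsPrimitiveElt (0 : K) := by
  classical
  intro h
  have : (Finset.univ : Finset K) ⊆ {0, 1} := by
    intro b _
    by_cases hb : b = 0
    · simp [hb]
    obtain ⟨k, hk⟩ := h b hb
    rcases Nat.eq_zero_or_pos k with rfl | hk0
    · simp at hk; simp [← hk]
    · rw [zero_pow hk0.ne'] at hk; exact absurd hk.symm hb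
  have h3 := Finset.card_le_card this
  have h4 : ({0, 1} : Finset K).card ≤ 2 := Finset.card_le_two
  rw [Finset.card_univ] at h3
  omega

lemma core [DecidableEq K] (f : F[X]) (hf : f ≠ 0) (hfd : f ∣ X ^ (Module.finrank F K) - 1)
    (hc : IsCoprime f (X ^ (Module.finrank F E) - 1)) (β : E) (h2 : 2 < Fintype.card K)
    (θ T : ℝ) (hθ : θ = (Nat.totient (Fintype.card Kˣ) : ℝ) / (Fintype.card Kˣ))
    (hT : T = ∏ P ∈ PF f, (1 - 1 / (Fintype.card F : ℝ) ^ P.natDegree)) :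
    θ * ((Fintype.card F : ℝ) ^ (Module.finrank F K - Module.finrank F E) * T
      - 2 ^ (PF f).card * T) - (2 ^ (Fintype.card Kˣ).primeFactors.card * θ - θ) *
        (2 ^ (PF f).card * T) * Real.sqrt (Fintype.card K)
    ≤ (Nat.card {w : K // IsPrimitiveElt w ∧
        IsPolyFree (Fintype.card F) (Module.finrank F K) f w ∧ Algebra.trace E K w = β} : ℝ) := by
  classical
  have hθ0 : 0 ≤ θ := by rw [hθ]; positivity
  have hA := AA_rep (K := K) f hf hfd β
  rw [← hT] at hA
  have hM := rep_M (K := K)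
  have hmean := mean_M (K := K)
  rw [← hθ] at hM hmean
  have key := main_estimate _ _ _ _ θ hθ0 hM hA hmean
  have hs := AA_sum (K := K) f hf hfd hc β
  rw [← hT, sum_units_eq] at hs
  have hN : (∑ u : Kˣ, (∏ l ∈ (Fintype.card Kˣ).primeFactors,
      fun x : Additive Kˣ => if x ∈ Hl K l then (0 : ℂ) else 1) (Additive.ofMul u) * AA f β (u : K))
      = ((Nat.card {w : K // IsPrimitiveElt w ∧
        IsPolyFree (Fintype.card F) (Module.finrank F K) f w ∧ Algebra.trace E K w = β} : ℝ) : ℂ) := by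
    have e1 : ∀ u : Kˣ, (∏ l ∈ (Fintype.card Kˣ).primeFactors,
      fun x : Additive Kˣ => if x ∈ Hl K l then (0 : ℂ) else 1) (Additive.ofMul u) * AA f β (u : K)
      = (fun w : K => if IsPrimitiveElt w ∧
        IsPolyFree (Fintype.card F) (Module.finrank F K) f w ∧ Algebra.trace E K w = β then (1 : ℂ)
        else 0) (u : K) := by
      intro u
      rw [prod_Hl, AA_ind f hf hfd]
      dsimp only
      by_cases h : IsPrimitiveElt (u : K) <;> simp [h]
    rw [Finset.sum_congr rfl fun u _ => e1 u]
    have e2 := sum_units_eq (K := K) (fun w : K => if IsPrimitiveElt w ∧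
        IsPolyFree (Fintype.card F) (Module.finrank F K) f w ∧ Algebra.trace E K w = β then (1 : ℂ)
        else 0)
    rw [Finset.sum_boole, if_neg (fun h => not_prim_zero h2 h.1), zero_add] at e2
    rw [← e2, Nat.card_eq_fintype_card, Fintype.card_subtype]
    simp
  rw [hN] at key
  have hs' : ∑ u : Kˣ, AA f β (u : K) =
    (((Fintype.card F : ℝ) ^ (Module.finrank F K - Module.finrank F E) * T : ℝ) : ℂ)
      - AA f β (0 : K) := by rw [← hs]; ring
  rw [hs'] at key
  have h0 := (Complex.re_le_norm _).trans (hA.norm_le (0 : K))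
  rw [norm_sub_rev] at key
  have k1 := (Complex.re_le_norm _).trans key
  simp only [Complex.sub_re, Complex.re_ofReal_mul, Complex.ofReal_re] at k1
  have k2 := mul_le_mul_of_nonneg_left h0 hθ0
  linarith

lemma coprime_of (p e m : ℕ) (hp : p.Prime) (hcF : Fintype.card F = p ^ e) (he : 0 < e)
    (hm : m = 1 ∨ ∃ j : ℕ, m = p ^ j) (f : F[X]) (hfx : ¬ (X - 1 : F[X]) ∣ f) :
    IsCoprime f (X ^ m - 1) := by
  haveI := Fact.mk hp
  have hch : CharP F p := by
    obtain ⟨r, hr⟩ := CharP.exists F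
    obtain ⟨k, hrp, hk⟩ := FiniteField.card F r
    have : r = p := by
      have h1 : r ∣ p ^ e := by rw [← hcF, hk]; exact dvd_pow_self _ k.ne_zero
      exact (Nat.prime_dvd_prime_iff_eq hrp hp).1 (hrp.dvd_of_dvd_pow h1)
    rwa [← this]
  obtain ⟨j, rfl⟩ : ∃ j : ℕ, m = p ^ j := by
    rcases hm with rfl | h
    · exact ⟨0, by simp⟩
    · exact h
  have e1 : (X ^ p ^ j - 1 : F[X]) = (X - 1) ^ p ^ j := by
    rw [sub_pow_char_pow, one_pow]
  rw [e1]
  apply IsCoprime.pow_right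
  have hi : Irreducible (X - 1 : F[X]) := by
    have := irreducible_X_sub_C (1 : F); rwa [C_1] at this
  exact ((hi.coprime_iff_not_dvd).2 hfx).symm

end core

/-- Character-sum bound for the number `N` of elements of `F_{qⁿ}` that are primitive,
`f`-free over `F_q`, and have trace `β` in the subfield `F_{qᵐ}`:
`N / (θ(qⁿ-1) Θ(f)) > q^(n-m) - q^(n/2) W(qⁿ-1) W(f)`. -/
theorem stmt_5 (p e q n m : ℕ) (hp : p.Prime) (he : 0 < e) (hq : q = p ^ e)
    (hmn : m ∣ n) (hmlt : m < n) (hm : m = 1 ∨ ∃ j : ℕ, m = p ^ j)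
    (F E K : Type) [Field F] [Fintype F] [Field E] [Fintype E] [Field K] [Fintype K]
    [Algebra F E] [Algebra E K] [Algebra F K] [IsScalarTower F E K]
    (hcF : Fintype.card F = q) (hrE : Module.finrank F E = m) (hrK : Module.finrank F K = n)
    (f : F[X]) (hfm : f.Monic) (hfd : f ∣ X ^ n - 1) (hfx : ¬ (X - 1 : F[X]) ∣ f)
    (β : E) :
    (Nat.card {w : K // IsPrimitiveElt w ∧ IsPolyFree q n f w ∧ Algebra.trace E K w = β} : ℝ) /
        (((Nat.totient (q ^ n - 1) : ℝ) / ((q : ℝ) ^ n - 1)) *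
          ((PhiPoly f : ℝ) / (q : ℝ) ^ f.natDegree)) >
      (q : ℝ) ^ (n - m) -
        (q : ℝ) ^ ((n : ℝ) / 2) * (Wint (q ^ n - 1) : ℝ) * (Wpoly f : ℝ) := by
  classical
  have hq2 : 2 ≤ q := by
    rw [hq]; exact hp.two_le.trans (Nat.le_self_pow he.ne' p)
  have hcop := coprime_of p e m hp (hcF.trans hq) he hm f hfx
  subst hcF hrE hrK
  have hf0 : f ≠ 0 := hfm.ne_zero
  have hm1 : 1 ≤ Module.finrank F E := Module.finrank_pos
  have hcK : Fintype.card K = Fintype.card F ^ Module.finrank F K := Module.card_eq_pow_finrank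
  set q := Fintype.card F with hqd
  set n := Module.finrank F K with hnd
  set m := Module.finrank F E with hmd
  have hn2 : 2 ≤ n := by omega
  have h4 : 2 ^ 2 ≤ q ^ n := (Nat.pow_le_pow_left hq2 2).trans (Nat.pow_le_pow_right (by omega) hn2)
  have hcU : Fintype.card Kˣ = q ^ n - 1 := by rw [Fintype.card_units, hcK]
  have hqR : (2 : ℝ) ≤ q := by exact_mod_cast hq2
  have hq0 : (0 : ℝ) < q := by linarith
  obtain ⟨T, hT⟩ : ∃ T : ℝ, T = ∏ P ∈ PF f, (1 - 1 / (q : ℝ) ^ P.natDegree) := ⟨_, rfl⟩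
  obtain ⟨θ, hθ⟩ : ∃ θ : ℝ, θ = (Nat.totient (Fintype.card Kˣ) : ℝ) / (Fintype.card Kˣ) := ⟨_, rfl⟩
  have hc := core (K := K) f hf0 hfd hcop β (by rw [hcK]; omega) θ T hθ hT
  have hPhi : (PhiPoly f : ℝ) / (q : ℝ) ^ f.natDegree = T := by
    rw [phi_formula f hf0, ← hqd, ← hT]
    field_simp
  have hcast : (Fintype.card Kˣ : ℝ) = (q : ℝ) ^ n - 1 := by
    rw [hcU, Nat.cast_sub (by omega)]; push_cast; ring
  have hTot : (Nat.totient (q ^ n - 1) : ℝ) / ((q : ℝ) ^ n - 1) = θ := by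
    rw [hθ, hcast, hcU]
  have hθ0 : 0 < θ := by
    rw [hθ]
    have h1 : 0 < Fintype.card Kˣ := Fintype.card_pos
    have h2 : 0 < Nat.totient (Fintype.card Kˣ) := Nat.totient_pos.2 h1
    positivity
  have hT0 : 0 < T := by
    rw [hT]
    refine Finset.prod_pos fun P hP => ?_
    have hd : P.natDegree ≠ 0 := ((mem_PF hf0).1 hP).1.natDegree_pos.ne'
    have h1 : (1 : ℝ) < (q : ℝ) ^ P.natDegree := one_lt_pow₀ (by linarith) hd
    rw [sub_pos, div_lt_one (by linarith)]
    exact h1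
  have hsq : Real.sqrt (Fintype.card K) = (q : ℝ) ^ ((n : ℝ) / 2) := by
    rw [hcK, Real.sqrt_eq_rpow]
    push_cast
    rw [← Real.rpow_natCast, ← Real.rpow_mul hq0.le]
    congr 1
    ring
  have hW1 : (2 : ℝ) ^ (Fintype.card Kˣ).primeFactors.card ≤ Wint (q ^ n - 1) := by
    rw [hcU]; exact_mod_cast Wint_ge (q ^ n - 1) (by omega)
  have hW2 : (2 : ℝ) ^ (PF f).card ≤ Wpoly f := by exact_mod_cast PF_card_le f hf0
  have hR1 : (1 : ℝ) < (q : ℝ) ^ ((n : ℝ) / 2) := by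
    apply Real.one_lt_rpow (by linarith)
    have : (0 : ℝ) < n := by exact_mod_cast (by omega : 0 < n)
    positivity
  rw [hsq] at hc
  rw [hPhi, hTot, gt_iff_lt, lt_div_iff₀ (mul_pos hθ0 hT0)]
  refine lt_of_lt_of_le ?_ hc
  generalize (q : ℝ) ^ ((n : ℝ) / 2) = R at *
  generalize (q : ℝ) ^ (n - m) = Q at *
  have ha : (1 : ℝ) ≤ 2 ^ (Fintype.card Kˣ).primeFactors.card := one_le_pow₀ (by norm_num)
  have hb : (1 : ℝ) ≤ 2 ^ (PF f).card := one_le_pow₀ (by norm_num)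
  generalize (2 : ℝ) ^ (Fintype.card Kˣ).primeFactors.card = a at *
  generalize (2 : ℝ) ^ (PF f).card = b at *
  generalize (Wint (q ^ n - 1) : ℝ) = W1 at *
  generalize (Wpoly f : ℝ) = W2 at *
  have hRW : 0 ≤ R * W1 := mul_nonneg (by linarith) (by linarith)
  have h1 : R * a * b ≤ R * W1 * W2 := by gcongr
  have h2 : b < R * b := by nlinarith
  have h3 : Q - R * W1 * W2 < Q - b - (a - 1) * b * R := by nlinarith
  have h5 := mul_lt_mul_of_pos_right h3 (mul_pos hθ0 hT0)
  calc _ < _ := h5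
    _ = _ := by ring

end
end
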